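/- arXiv:2406.02493 — 3 statements merged into one kernel-verified Lean document; each statement's English description precedes it below -/
import Mathlib

section
/- Let P be a finite poset with an order-reversing involution κ : P → P, and for I ∈ J(P) let I′ denote the order ideal generated by κ(max(I)). Fix ℓ ∈ P and an order ideal I ∈ J(P). (1) If I and I′ lie in the same rowmotion orbit O, then Σ_{J ∈ O} (χ_ℓ(J) − χ_{κ(ℓ)}(J)) = 0. (2) If I lies in the rowmotion orbit O and I′ lies in a different rowmotion orbit O′, then #O = #O′ and Σ_{J ∈ O} (χ_ℓ(J) − χ_{κ(ℓ)}(J)) + Σ_{J ∈ O′} (χ_ℓ(J) − χ_{κ(ℓ)}(J)) = 0. -/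
open scoped Classical

namespace Row

variable {P : Type*} [PartialOrder P] [Fintype P]

/-- the order ideals (lower sets) of `P`. -/
abbrev OIdeal (P : Type*) [PartialOrder P] := {S : Set P // IsLowerSet S}

/-- the set of maximal elements of `S`. -/
def maxIn (S : Set P) : Set P := {p | p ∈ S ∧ ∀ q ∈ S, p ≤ q → q = p}

/-- the set of minimal elements of the complement of `S`. -/
def minOut (S : Set P) : Set P := {p | p ∉ S ∧ ∀ q ∉ S, q ≤ p → q = p}

/-- rowmotion: `ρ(I)` is the order ideal generated by the minimal elements of `P ∖ I`. -/
def rho (I : OIdeal P) : OIdeal P :=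
  ⟨{x | ∃ y ∈ minOut I.1, x ≤ y}, by
    intro u v hle hu
    obtain ⟨y, hy, h⟩ := hu
    exact ⟨y, hy, hle.trans h⟩⟩

/-- the order ideal generated by a set `A`. -/
def genIdeal (A : Set P) : OIdeal P :=
  ⟨{x | ∃ y ∈ A, x ≤ y}, by
    intro u v hle hu
    obtain ⟨y, hy, h⟩ := hu
    exact ⟨y, hy, hle.trans h⟩⟩

/-- `I′`: the order ideal generated by `κ(max I)`. -/
def primeI (κ : P → P) (I : OIdeal P) : OIdeal P := genIdeal (κ '' maxIn I.1)

/-- the antichain indicator `χ_p(I)`. -/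
noncomputable def chiA (p : P) (I : OIdeal P) : ℝ := if p ∈ maxIn I.1 then 1 else 0

/-- the (forward) orbit of `x` under `ρ`. -/
def orbit {X : Type*} (ρ : X → X) (x : X) : Set X := {y | ∃ k : ℕ, ρ^[k] x = y}


theorem iter_return {X : Type*} [Finite X] (ρ : X → X) (hρ : Function.Injective ρ) (x : X) :
    ∃ n, 0 < n ∧ ρ^[n] x = x := by
  obtain ⟨n, hn, h⟩ := hρ.mem_periodicPts x
  exact ⟨n, hn, h⟩

theorem orbit_symm {X : Type*} [Finite X] {ρ : X → X} (hρ : Function.Injective ρ) {x y : X}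
    (h : y ∈ orbit ρ x) : x ∈ orbit ρ y := by
  obtain ⟨k, rfl⟩ := h
  obtain ⟨n, hn, hx⟩ := iter_return ρ hρ x
  have hk : k ≤ n * k := Nat.le_mul_of_pos_left k hn
  refine ⟨n * k - k, ?_⟩
  rw [← Function.iterate_add_apply, Nat.sub_add_cancel hk, Function.iterate_mul]
  exact Function.iterate_fixed hx k

theorem orbit_trans {X : Type*} {ρ : X → X} {x y z : X}
    (h : y ∈ orbit ρ x) (h' : z ∈ orbit ρ y) : z ∈ orbit ρ x := by
  obtain ⟨k, rfl⟩ := h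
  obtain ⟨m, rfl⟩ := h'
  exact ⟨m + k, Function.iterate_add_apply _ _ _ _⟩

theorem orbit_eq {X : Type*} [Finite X] {ρ : X → X} (hρ : Function.Injective ρ) {x y : X}
    (h : y ∈ orbit ρ x) : orbit ρ y = orbit ρ x :=
  Set.Subset.antisymm (fun _ hz => orbit_trans h hz)
    (fun _ hz => orbit_trans (orbit_symm hρ h) hz)

theorem iter_conj {X : Type*} {ρ σ : X → X} (h : ∀ x, ρ (σ (ρ x)) = σ x) (k : ℕ) (x : X) :
    ρ^[k] (σ (ρ^[k] x)) = σ x := by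
  induction k generalizing x with
  | zero => rfl
  | succ k ih =>
    rw [Function.iterate_succ_apply' ρ k (σ _), Function.iterate_succ_apply ρ k x, ih, h]

theorem orbit_conj {X : Type*} [Finite X] {ρ σ : X → X} (hρ : Function.Injective ρ)
    (hσ : Function.Involutive σ) (h : ∀ x, ρ (σ (ρ x)) = σ x) (x : X) :
    orbit ρ (σ x) = σ '' orbit ρ x := by
  have key : ∀ x y, y ∈ orbit ρ x → σ y ∈ orbit ρ (σ x) := by
    rintro x _ ⟨k, rfl⟩
    exact orbit_symm hρ ⟨k, iter_conj h k x⟩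
  ext y
  constructor
  · intro hy
    refine ⟨σ y, ?_, hσ y⟩
    have := key _ _ hy
    rwa [hσ x] at this
  · rintro ⟨z, hz, rfl⟩
    exact key _ _ hz

theorem exists_minOut {P : Type*} [PartialOrder P] [Fintype P] (S : Set P) {x : P}
    (hx : x ∉ S) : ∃ y ∈ minOut S, y ≤ x := by
  obtain ⟨y, hyx, hy⟩ := (Set.toFinite (Sᶜ)).exists_le_minimal hx
  exact ⟨y, ⟨hy.1, fun q hq h => le_antisymm h (hy.2 hq h)⟩, hyx⟩

theorem exists_maxIn {P : Type*} [PartialOrder P] [Fintype P] (S : Set P) {x : P}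
    (hx : x ∈ S) : ∃ y ∈ maxIn S, x ≤ y := by
  obtain ⟨y, hyx, hy⟩ := (Set.toFinite S).exists_le_maximal hx
  exact ⟨y, ⟨hy.1, fun q hq h => le_antisymm (hy.2 hq h) h⟩, hyx⟩

theorem genIdeal_maxIn {P : Type*} [PartialOrder P] [Fintype P] (I : OIdeal P) :
    genIdeal (maxIn I.1) = I := by
  apply Subtype.ext
  ext x
  constructor
  · rintro ⟨y, hy, h⟩
    exact I.2 h hy.1
  · intro hx
    exact exists_maxIn _ hx

theorem maxIn_genIdeal {P : Type*} [PartialOrder P] [Fintype P] (A : Set P)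
    (hA : ∀ x ∈ A, ∀ y ∈ A, x ≤ y → y = x) : maxIn (genIdeal A).1 = A := by
  ext x
  constructor
  · rintro ⟨⟨y, hy, hxy⟩, h⟩
    have := h y ⟨y, hy, le_rfl⟩ hxy
    rwa [← this]
  · intro hx
    refine ⟨⟨x, hx, le_rfl⟩, ?_⟩
    rintro q ⟨z, hz, hqz⟩ hxq
    have := hA x hx z hz (hxq.trans hqz)
    subst this
    exact le_antisymm hqz hxq

theorem maxIn_rho {P : Type*} [PartialOrder P] [Fintype P] (I : OIdeal P) :
    maxIn (rho I).1 = minOut I.1 :=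
  maxIn_genIdeal (minOut I.1) (fun x hx y hy h => (hy.2 x hx.1 h).symm)

theorem maxIn_primeI {P : Type*} [PartialOrder P] [Fintype P]
    (κ : P → P) (hinv : Function.Involutive κ)
    (hrev : ∀ x y : P, x ≤ y → κ y ≤ κ x) (I : OIdeal P) :
    maxIn (primeI κ I).1 = κ '' maxIn I.1 := by
  apply maxIn_genIdeal
  rintro _ ⟨x, hx, rfl⟩ _ ⟨y, hy, rfl⟩ h
  have h' := hrev _ _ h
  rw [hinv, hinv] at h'
  rw [hy.2 x hx.1 h']

theorem primeI_invol {P : Type*} [PartialOrder P] [Fintype P]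
    (κ : P → P) (hinv : Function.Involutive κ)
    (hrev : ∀ x y : P, x ≤ y → κ y ≤ κ x) : Function.Involutive (primeI (P := P) κ) := by
  intro I
  rw [primeI, maxIn_primeI κ hinv hrev, ← Set.image_comp, hinv.comp_self, Set.image_id,
    genIdeal_maxIn]

theorem rho_conj {P : Type*} [PartialOrder P] [Fintype P]
    (κ : P → P) (hinv : Function.Involutive κ)
    (hrev : ∀ x y : P, x ≤ y → κ y ≤ κ x) (I : OIdeal P) :
    rho (primeI κ (rho I)) = primeI κ I := by
  have h1 : ∀ x, x ∈ (primeI κ (rho I)).1 ↔ κ x ∉ I.1 := by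
    intro x
    have : x ∈ (primeI κ (rho I)).1 ↔ ∃ y ∈ κ '' minOut I.1, x ≤ y := by
      rw [← maxIn_rho]; rfl
    rw [this]
    constructor
    · rintro ⟨_, ⟨y, hy, rfl⟩, h⟩ hx
      have h' := hrev _ _ h
      rw [hinv] at h'
      exact hy.1 (I.2 h' hx)
    · intro hx
      obtain ⟨y, hy, h⟩ := exists_minOut _ hx
      refine ⟨κ y, ⟨y, hy, rfl⟩, ?_⟩
      have h' := hrev _ _ h
      rwa [hinv] at h'
  have h2 : minOut (primeI κ (rho I)).1 = κ '' maxIn I.1 := by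
    ext x
    constructor
    · rintro ⟨hx, h⟩
      rw [h1, not_not] at hx
      refine ⟨κ x, ⟨hx, fun q hq hxq => ?_⟩, hinv x⟩
      have h' := hrev _ _ hxq
      rw [hinv] at h'
      have := h (κ q) (by rw [h1, not_not, hinv]; exact hq) h'
      rw [← this, hinv]
    · rintro ⟨y, hy, rfl⟩
      refine ⟨by rw [h1, not_not, hinv]; exact hy.1, fun q hq hqy => ?_⟩
      rw [h1, not_not] at hq
      have h' := hrev _ _ hqy
      rw [hinv] at h'
      rw [← hy.2 _ hq h', hinv]
  change genIdeal (minOut (primeI κ (rho I)).1) = genIdeal (κ '' maxIn I.1)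
  rw [h2]

theorem chiA_primeI {P : Type*} [PartialOrder P] [Fintype P]
    (κ : P → P) (hinv : Function.Involutive κ)
    (hrev : ∀ x y : P, x ≤ y → κ y ≤ κ x) (p : P) (I : OIdeal P) :
    chiA p (primeI κ I) = chiA (κ p) I := by
  have : p ∈ maxIn (primeI κ I).1 ↔ κ p ∈ maxIn I.1 := by
    rw [maxIn_primeI κ hinv hrev]
    constructor
    · rintro ⟨y, hy, rfl⟩
      rwa [hinv]
    · intro h
      exact ⟨_, h, hinv p⟩
  simp only [chiA, this]

/-- Corollary `ac - kappa ac`.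
Let `P` be a finite poset with an order-reversing involution `κ`, `I′` the order ideal
generated by `κ(max I)`, and fix `ℓ ∈ P` and `I ∈ J(P)`.
(1) If `I` and `I′` lie in the same rowmotion orbit `O`, then
`Σ_{K ∈ O} (χ_ℓ(K) − χ_{κ(ℓ)}(K)) = 0`.
(2) If `I′` lies in a different orbit `O′`, then `#O = #O′` and the two orbit sums of
`χ_ℓ − χ_{κ(ℓ)}` add to `0`. -/
theorem statement15 {P : Type*} [PartialOrder P] [Fintype P]
    (κ : P → P) (hinv : Function.Involutive κ)
    (hrev : ∀ x y : P, x ≤ y → κ y ≤ κ x)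
    (ℓ : P) (I : OIdeal P) :
    (primeI κ I ∈ orbit rho I →
      ∑ᶠ K ∈ orbit rho I, (chiA ℓ K - chiA (κ ℓ) K) = 0)
    ∧ (primeI κ I ∉ orbit rho I →
      (orbit rho I).ncard = (orbit rho (primeI κ I)).ncard ∧
        (∑ᶠ K ∈ orbit rho I, (chiA ℓ K - chiA (κ ℓ) K))
          + (∑ᶠ K ∈ orbit rho (primeI κ I), (chiA ℓ K - chiA (κ ℓ) K)) = 0) := by
  have hσ := primeI_invol κ hinv hrev
  have hc := rho_conj κ hinv hrev
  have hρ : Function.Injective (rho (P := P)) := by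
    intro A B hAB
    apply hσ.injective
    rw [← hc A, ← hc B, hAB]
  have ho := orbit_conj hρ hσ hc I
  have hs : (∑ᶠ K ∈ orbit rho (primeI κ I), (chiA ℓ K - chiA (κ ℓ) K))
      = - ∑ᶠ K ∈ orbit rho I, (chiA ℓ K - chiA (κ ℓ) K) := by
    rw [ho, finsum_mem_image hσ.injective.injOn, ← finsum_mem_neg_distrib _ (Set.toFinite _)]
    refine finsum_mem_congr rfl fun K _ => ?_
    rw [chiA_primeI κ hinv hrev, chiA_primeI κ hinv hrev, hinv, neg_sub]
  refine ⟨fun h => ?_, fun _ => ⟨?_, ?_⟩⟩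
  · rw [orbit_eq hρ h] at hs
    linarith
  · rw [ho, Set.ncard_image_of_injective _ hσ.injective]
  · rw [hs, add_neg_cancel]

end Row
end

section
/- Let P be a finite poset, let π : P → ℝ_{>0} be a labeling, and let p ∈ P. Then the birational toggleability statistic T_p^B is multiplicatively 1-mesic along the ρ^B-orbit of π: lim_{n→∞} (∏_{i=0}^{n−1} T_p^B((ρ^B)^i(π)))^{1/n} = 1. -/
open scoped Classical

namespace Birational

variable {P : Type*} [PartialOrder P] [Fintype P]

/-- the poset `P̂ = P ∪ {0̂, 1̂}`. -/
abbrev Phat (P : Type*) := WithBot (WithTop P)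

/-- the inclusion `P → P̂`. -/
def toHat (p : P) : Phat P := ((p : WithTop P) : WithBot (WithTop P))

/-- extend a labeling `π : P → ℝ` to `P̂` by `π(0̂) = aB` and `π(1̂) = wB`. -/
noncomputable def extLab (aB wB : ℝ) (π : P → ℝ) : Phat P → ℝ :=
  WithBot.recBotCoe aB (WithTop.recTopCoe wB π)

/-- `Σ_{r ⋖ p in P̂} π̂(r)`. -/
noncomputable def belowSum (aB wB : ℝ) (π : P → ℝ) (p : P) : ℝ :=
  ∑ᶠ r ∈ {r : Phat P | r ⋖ toHat p}, extLab aB wB π r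

/-- `Σ_{p ⋖ r in P̂} π̂(r)⁻¹`. -/
noncomputable def aboveInvSum (aB wB : ℝ) (π : P → ℝ) (p : P) : ℝ :=
  ∑ᶠ r ∈ {r : Phat P | toHat p ⋖ r}, (extLab aB wB π r)⁻¹

/-- the birational toggle `τ_p^B`. -/
noncomputable def btoggle (aB wB : ℝ) (p : P) (π : P → ℝ) : P → ℝ :=
  fun q => if q = p then belowSum aB wB π p / (π p * aboveInvSum aB wB π p) else π q

/-- `e` enumerates a linear extension `p_1, …, p_n` of `P` (via `p_i = e (i-1)`). -/
def IsLinearExtension (e : Fin (Fintype.card P) ≃ P) : Prop :=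
  ∀ i j : Fin (Fintype.card P), e i ≤ e j → i ≤ j

/-- birational rowmotion `ρ^B = τ_{p_1}^B ∘ ⋯ ∘ τ_{p_n}^B` (toggled right to left). -/
noncomputable def brho (aB wB : ℝ) (e : Fin (Fintype.card P) ≃ P) : (P → ℝ) → P → ℝ :=
  (List.finRange (Fintype.card P)).foldr (fun i g => btoggle aB wB (e i) ∘ g) id

/-- `T_p^{+,B}`. -/
noncomputable def TplusB (aB wB : ℝ) (p : P) (π : P → ℝ) : ℝ :=
  π p / belowSum aB wB π p

/-- `T_p^{−,B}`. -/
noncomputable def TminusB (aB wB : ℝ) (p : P) (π : P → ℝ) : ℝ :=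
  1 / (π p * aboveInvSum aB wB π p)

/-- the birational toggleability statistic `T_p^B = T_p^{+,B} / T_p^{−,B}`. -/
noncomputable def TB (aB wB : ℝ) (p : P) (π : P → ℝ) : ℝ :=
  TplusB aB wB p π / TminusB aB wB p π


instance phatFinite : Finite (Phat P) := inferInstanceAs (Finite (Option (Option P)))

noncomputable instance phatFintype : Fintype (Phat P) := Fintype.ofFinite _

lemma belowSum_eq (aB wB : ℝ) (π : P → ℝ) (p : P) :
    belowSum aB wB π p = ∑ r : Phat P, if r ⋖ toHat p then extLab aB wB π r else 0 := by
  unfold belowSum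
  rw [finsum_mem_eq_finite_toFinset_sum _ (Set.toFinite _), ← Finset.sum_filter]
  apply Finset.sum_congr
  · ext; simp
  · intros; rfl

lemma aboveInvSum_eq (aB wB : ℝ) (π : P → ℝ) (p : P) :
    aboveInvSum aB wB π p =
      ∑ r : Phat P, if toHat p ⋖ r then (extLab aB wB π r)⁻¹ else 0 := by
  unfold aboveInvSum
  rw [finsum_mem_eq_finite_toFinset_sum _ (Set.toFinite _), ← Finset.sum_filter]
  apply Finset.sum_congr
  · ext; simp
  · intros; rfl

lemma phat_cases (x : Phat P) : x = ⊥ ∨ x = ⊤ ∨ ∃ p : P, x = toHat p := by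
  induction x using WithBot.recBotCoe with
  | bot => left; rfl
  | coe x =>
    induction x using WithTop.recTopCoe with
    | top => right; left; rfl
    | coe p => right; right; exact ⟨p, rfl⟩

lemma extLab_pos {aB wB : ℝ} (haB : 0 < aB) (hwB : 0 < wB) {π : P → ℝ}
    (hπ : ∀ p, 0 < π p) (x : Phat P) : 0 < extLab aB wB π x := by
  rcases phat_cases x with rfl | rfl | ⟨p, rfl⟩
  · exact haB
  · exact hwB
  · exact hπ p

lemma exists_below (x : Phat P) (hx : x ≠ ⊥) : ∃ r, r ⋖ x :=
  exists_covBy_of_wellFoundedGT (by rwa [isMin_iff_eq_bot])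

lemma exists_above (x : Phat P) (hx : x ≠ ⊤) : ∃ r, x ⋖ r :=
  exists_covBy_of_wellFoundedLT (by rwa [isMax_iff_eq_top])

lemma toHat_ne_bot (p : P) : toHat p ≠ ⊥ := WithBot.coe_ne_bot

lemma toHat_ne_top (p : P) : toHat p ≠ ⊤ := by
  intro h
  exact WithTop.coe_ne_top (WithBot.coe_injective h)

lemma toHat_le {p q : P} : toHat p ≤ toHat q ↔ p ≤ q := by simp [toHat]

lemma toHat_inj {p q : P} : toHat p = toHat q ↔ p = q := by simp [toHat]

lemma belowSum_pos {aB wB : ℝ} (haB : 0 < aB) (hwB : 0 < wB) {π : P → ℝ}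
    (hπ : ∀ p, 0 < π p) (p : P) : 0 < belowSum aB wB π p := by
  rw [belowSum_eq]
  obtain ⟨r, hr⟩ := exists_below _ (toHat_ne_bot p)
  refine Finset.sum_pos' (fun x _ => ?_) ⟨r, Finset.mem_univ _, ?_⟩
  · split_ifs
    · exact (extLab_pos haB hwB hπ x).le
    · exact le_rfl
  · rw [if_pos hr]; exact extLab_pos haB hwB hπ r

lemma aboveInvSum_pos {aB wB : ℝ} (haB : 0 < aB) (hwB : 0 < wB) {π : P → ℝ}
    (hπ : ∀ p, 0 < π p) (p : P) : 0 < aboveInvSum aB wB π p := by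
  rw [aboveInvSum_eq]
  obtain ⟨r, hr⟩ := exists_above _ (toHat_ne_top p)
  refine Finset.sum_pos' (fun x _ => ?_) ⟨r, Finset.mem_univ _, ?_⟩
  · split_ifs
    · exact (inv_pos.2 (extLab_pos haB hwB hπ x)).le
    · exact le_rfl
  · rw [if_pos hr]; exact inv_pos.2 (extLab_pos haB hwB hπ r)

lemma btoggle_pos {aB wB : ℝ} (haB : 0 < aB) (hwB : 0 < wB) {π : P → ℝ}
    (hπ : ∀ p, 0 < π p) (p q : P) : 0 < btoggle aB wB p π q := by
  unfold btoggle
  split_ifs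
  · exact div_pos (belowSum_pos haB hwB hπ p) (mul_pos (hπ p) (aboveInvSum_pos haB hwB hπ p))
  · exact hπ q

/-- The superpotential: the sum of `π(x) / π(y)` over the covers `x ⋖ y` of `P̂`. -/
noncomputable def superpot (aB wB : ℝ) (π : P → ℝ) : ℝ :=
  ∑ x : Phat P, ∑ y : Phat P, if x ⋖ y then extLab aB wB π x / extLab aB wB π y else 0

lemma superpot_split (aB wB : ℝ) (π : P → ℝ) (p : P) :
    superpot aB wB π = belowSum aB wB π p / π p + π p * aboveInvSum aB wB π p +
      ∑ x ∈ Finset.univ.erase (toHat p), ∑ y ∈ Finset.univ.erase (toHat p),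
        if x ⋖ y then extLab aB wB π x / extLab aB wB π y else 0 := by
  have hp : extLab aB wB π (toHat p) = π p := rfl
  have h1 : π p * aboveInvSum aB wB π p =
      ∑ y : Phat P, if toHat p ⋖ y then extLab aB wB π (toHat p) / extLab aB wB π y else 0 := by
    rw [aboveInvSum_eq, Finset.mul_sum]
    refine Finset.sum_congr rfl fun y _ => ?_
    rw [hp]
    split_ifs
    · rw [div_eq_mul_inv]
    · simp
  have h2 : belowSum aB wB π p / π p = ∑ x ∈ Finset.univ.erase (toHat p),
      if x ⋖ toHat p then extLab aB wB π x / extLab aB wB π (toHat p) else 0 := by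
    rw [belowSum_eq, Finset.sum_div, ← Finset.add_sum_erase _ _ (Finset.mem_univ (toHat p)),
      if_neg (fun h => h.lt.ne rfl), zero_div, zero_add]
    refine Finset.sum_congr rfl fun y _ => ?_
    rw [hp]
    split_ifs
    · rfl
    · simp
  rw [h1, h2, superpot, ← Finset.add_sum_erase _ _ (Finset.mem_univ (toHat p)), add_right_comm,
    ← Finset.sum_add_distrib, add_comm]
  congr 1
  refine Finset.sum_congr rfl fun x _ => ?_
  rw [← Finset.add_sum_erase _ _ (Finset.mem_univ (toHat p))]

lemma extLab_congr {aB wB : ℝ} {π σ : P → ℝ} {x : Phat P}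
    (h : ∀ q, x = toHat q → π q = σ q) : extLab aB wB π x = extLab aB wB σ x := by
  rcases phat_cases x with rfl | rfl | ⟨q, rfl⟩
  · rfl
  · rfl
  · exact h q rfl

lemma belowSum_congr {aB wB : ℝ} {π σ : P → ℝ} {p : P}
    (h : ∀ q, q < p → π q = σ q) : belowSum aB wB π p = belowSum aB wB σ p := by
  rw [belowSum_eq, belowSum_eq]
  refine Finset.sum_congr rfl fun x _ => ?_
  split_ifs with hx
  · refine extLab_congr fun q hq => h q ?_
    subst hq
    exact lt_of_le_of_ne (toHat_le.1 hx.lt.le) (fun h => hx.lt.ne (toHat_inj.2 h))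
  · rfl

lemma aboveInvSum_congr {aB wB : ℝ} {π σ : P → ℝ} {p : P}
    (h : ∀ q, p < q → π q = σ q) : aboveInvSum aB wB π p = aboveInvSum aB wB σ p := by
  rw [aboveInvSum_eq, aboveInvSum_eq]
  refine Finset.sum_congr rfl fun x _ => ?_
  split_ifs with hx
  · congr 1
    refine extLab_congr fun q hq => h q ?_
    subst hq
    exact lt_of_le_of_ne (toHat_le.1 hx.lt.le) (fun h => hx.lt.ne (toHat_inj.2 h))
  · rfl

lemma btoggle_of_ne (aB wB : ℝ) (π : P → ℝ) {p q : P} (h : q ≠ p) :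
    btoggle aB wB p π q = π q := if_neg h

lemma superpot_btoggle {aB wB : ℝ} (haB : 0 < aB) (hwB : 0 < wB) {π : P → ℝ}
    (hπ : ∀ p, 0 < π p) (p : P) :
    superpot aB wB (btoggle aB wB p π) = superpot aB wB π := by
  rw [superpot_split _ _ _ p, superpot_split _ _ π p]
  have hb : belowSum aB wB (btoggle aB wB p π) p = belowSum aB wB π p :=
    belowSum_congr fun q hq => btoggle_of_ne _ _ _ hq.ne
  have ha : aboveInvSum aB wB (btoggle aB wB p π) p = aboveInvSum aB wB π p :=
    aboveInvSum_congr fun q hq => btoggle_of_ne _ _ _ hq.ne'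
  have hv : btoggle aB wB p π p = belowSum aB wB π p / (π p * aboveInvSum aB wB π p) :=
    if_pos rfl
  have hx : ∀ x ∈ Finset.univ.erase (toHat p),
      extLab aB wB (btoggle aB wB p π) x = extLab aB wB π x := by
    intro x hx
    refine extLab_congr fun q hq => btoggle_of_ne _ _ _ ?_
    rintro rfl
    exact (Finset.ne_of_mem_erase hx) hq
  rw [hb, ha, hv]
  congr 1
  · have h1 := belowSum_pos haB hwB hπ p
    have h2 := aboveInvSum_pos haB hwB hπ p
    have h3 := hπ p
    field_simp
    ring
  · refine Finset.sum_congr rfl fun x hx' => Finset.sum_congr rfl fun y hy' => ?_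
    rw [hx x hx', hx y hy']

lemma ratio_le {aB wB : ℝ} (haB : 0 < aB) (hwB : 0 < wB) {π : P → ℝ}
    (hπ : ∀ p, 0 < π p) {x y : Phat P} (h : x ⋖ y) :
    extLab aB wB π x ≤ superpot aB wB π * extLab aB wB π y := by
  have hnn : ∀ x y : Phat P,
      0 ≤ if x ⋖ y then extLab aB wB π x / extLab aB wB π y else 0 := by
    intro x y
    split_ifs
    · exact (div_pos (extLab_pos haB hwB hπ x) (extLab_pos haB hwB hπ y)).le
    · exact le_rfl
  rw [← div_le_iff₀ (extLab_pos haB hwB hπ y)]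
  calc extLab aB wB π x / extLab aB wB π y
      = if x ⋖ y then extLab aB wB π x / extLab aB wB π y else 0 := (if_pos h).symm
    _ ≤ ∑ y : Phat P, if x ⋖ y then extLab aB wB π x / extLab aB wB π y else 0 :=
        Finset.single_le_sum
          (f := fun y => if x ⋖ y then extLab aB wB π x / extLab aB wB π y else 0)
          (fun y _ => hnn x y) (Finset.mem_univ y)
    _ ≤ superpot aB wB π :=
        Finset.single_le_sum
          (f := fun x => ∑ y : Phat P,
            if x ⋖ y then extLab aB wB π x / extLab aB wB π y else 0)
          (fun x _ => Finset.sum_nonneg fun y _ => hnn x y) (Finset.mem_univ x)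

lemma superpot_pos {aB wB : ℝ} (haB : 0 < aB) (hwB : 0 < wB) {π : P → ℝ}
    (hπ : ∀ p, 0 < π p) (p : P) : 0 < superpot aB wB π := by
  obtain ⟨r, hr⟩ := exists_below _ (toHat_ne_bot p)
  have h := ratio_le haB hwB hπ hr
  have h1 := extLab_pos haB hwB hπ r
  have h2 := extLab_pos haB hwB hπ (toHat p)
  by_contra hc
  nlinarith

lemma exists_upper {aB wB : ℝ} (haB : 0 < aB) (hwB : 0 < wB) (W : ℝ) (hW : 0 < W)
    (x : Phat P) : ∃ C : ℝ, 0 < C ∧ ∀ π : P → ℝ, (∀ p, 0 < π p) → superpot aB wB π = W →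
      extLab aB wB π x ≤ C := by
  induction x using WellFoundedGT.induction with
  | ind x ih =>
    by_cases hx : x = ⊤
    · subst hx
      exact ⟨wB, hwB, fun π _ _ => le_rfl⟩
    · obtain ⟨r, hr⟩ := exists_above x hx
      obtain ⟨C, hC, h⟩ := ih r hr.lt
      refine ⟨W * C, mul_pos hW hC, fun π hπ hs => ?_⟩
      refine (ratio_le haB hwB hπ hr).trans ?_
      rw [hs]
      exact mul_le_mul_of_nonneg_left (h π hπ hs) hW.le

lemma exists_lower {aB wB : ℝ} (haB : 0 < aB) (hwB : 0 < wB) (W : ℝ) (hW : 0 < W)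
    (x : Phat P) : ∃ c : ℝ, 0 < c ∧ ∀ π : P → ℝ, (∀ p, 0 < π p) → superpot aB wB π = W →
      c ≤ extLab aB wB π x := by
  induction x using WellFoundedLT.induction with
  | ind x ih =>
    by_cases hx : x = ⊥
    · subst hx
      exact ⟨aB, haB, fun π _ _ => le_rfl⟩
    · obtain ⟨r, hr⟩ := exists_below x hx
      obtain ⟨c, hc, h⟩ := ih r hr.lt
      refine ⟨c / W, div_pos hc hW, fun π hπ hs => ?_⟩
      rw [div_le_iff₀' hW]
      have := ratio_le haB hwB hπ hr
      rw [hs] at this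
      exact (h π hπ hs).trans this

/-- partial rowmotion along a list of indices. -/
noncomputable def partRho (aB wB : ℝ) (e : Fin (Fintype.card P) ≃ P)
    (l : List (Fin (Fintype.card P))) : (P → ℝ) → P → ℝ :=
  l.foldr (fun i g => btoggle aB wB (e i) ∘ g) id

lemma partRho_cons (aB wB : ℝ) (e : Fin (Fintype.card P) ≃ P)
    (i : Fin (Fintype.card P)) (l : List (Fin (Fintype.card P))) (π : P → ℝ) :
    partRho aB wB e (i :: l) π = btoggle aB wB (e i) (partRho aB wB e l π) := rfl

lemma partRho_append (aB wB : ℝ) (e : Fin (Fintype.card P) ≃ P)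
    (l l' : List (Fin (Fintype.card P))) (π : P → ℝ) :
    partRho aB wB e (l ++ l') π = partRho aB wB e l (partRho aB wB e l' π) := by
  induction l with
  | nil => rfl
  | cons i l ih => rw [List.cons_append, partRho_cons, partRho_cons, ih]

lemma partRho_inv {aB wB : ℝ} (haB : 0 < aB) (hwB : 0 < wB)
    (e : Fin (Fintype.card P) ≃ P) (l : List (Fin (Fintype.card P))) {π : P → ℝ}
    (hπ : ∀ p, 0 < π p) : (∀ p, 0 < partRho aB wB e l π p) ∧
      superpot aB wB (partRho aB wB e l π) = superpot aB wB π := by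
  induction l with
  | nil => exact ⟨hπ, rfl⟩
  | cons i l ih =>
    rw [partRho_cons, superpot_btoggle haB hwB ih.1]
    exact ⟨fun q => btoggle_pos haB hwB ih.1 _ _, ih.2⟩

lemma partRho_of_notMem (aB wB : ℝ) (e : Fin (Fintype.card P) ≃ P)
    (l : List (Fin (Fintype.card P))) (π : P → ℝ) {j : Fin (Fintype.card P)} (hj : j ∉ l) :
    partRho aB wB e l π (e j) = π (e j) := by
  induction l with
  | nil => rfl
  | cons i l ih =>
    rw [List.mem_cons, not_or] at hj
    rw [partRho_cons, btoggle_of_ne _ _ _ (fun h => hj.1 (e.injective h)), ih hj.2]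

lemma brho_apply (aB wB : ℝ) (e : Fin (Fintype.card P) ≃ P) (he : IsLinearExtension e)
    (π : P → ℝ) (p : P) :
    brho aB wB e π p =
      belowSum aB wB π p / (π p * aboveInvSum aB wB (brho aB wB e π) p) := by
  obtain ⟨j, rfl⟩ := e.surjective p
  obtain ⟨l₁, l₂, hl⟩ := List.append_of_mem (List.mem_finRange j)
  have hs := List.pairwise_lt_finRange (Fintype.card P)
  rw [hl, List.pairwise_append, List.pairwise_cons] at hs
  obtain ⟨_, ⟨h2, _⟩, h3⟩ := hs
  have hb : brho aB wB e π =
      partRho aB wB e l₁ (btoggle aB wB (e j) (partRho aB wB e l₂ π)) := by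
    rw [← partRho_cons, ← partRho_append, ← hl]; rfl
  have hlt : ∀ i, i ∈ l₁ → i < j := fun i hi => h3 i hi j (by simp)
  have e1 : brho aB wB e π (e j) = btoggle aB wB (e j) (partRho aB wB e l₂ π) (e j) := by
    rw [hb, partRho_of_notMem _ _ _ _ _ (fun h => (hlt j h).ne rfl)]
  have e2 : partRho aB wB e l₂ π (e j) = π (e j) :=
    partRho_of_notMem _ _ _ _ _ (fun h => (h2 j h).ne rfl)
  have e3 : belowSum aB wB (partRho aB wB e l₂ π) (e j) = belowSum aB wB π (e j) := by
    refine belowSum_congr fun q hq => ?_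
    obtain ⟨i, rfl⟩ := e.surjective q
    exact partRho_of_notMem _ _ _ _ _ (fun h => absurd (h2 i h) (not_lt.2 (he _ _ hq.le)))
  have e4 : aboveInvSum aB wB (brho aB wB e π) (e j) =
      aboveInvSum aB wB (partRho aB wB e l₂ π) (e j) := by
    refine aboveInvSum_congr fun q hq => ?_
    obtain ⟨i, rfl⟩ := e.surjective q
    rw [hb, partRho_of_notMem _ _ _ _ _
      (fun h => absurd (hlt i h) (not_lt.2 (he _ _ hq.le))), btoggle_of_ne _ _ _ hq.ne']
  rw [e1, e4, btoggle, if_pos rfl, e2, e3]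

lemma brho_inv {aB wB : ℝ} (haB : 0 < aB) (hwB : 0 < wB)
    (e : Fin (Fintype.card P) ≃ P) {π : P → ℝ} (hπ : ∀ p, 0 < π p) (n : ℕ) :
    (∀ p, 0 < (brho aB wB e)^[n] π p) ∧
      superpot aB wB ((brho aB wB e)^[n] π) = superpot aB wB π := by
  induction n with
  | zero => exact ⟨hπ, rfl⟩
  | succ n ih =>
    rw [Function.iterate_succ_apply']
    have := partRho_inv haB hwB e (List.finRange _) ih.1
    exact ⟨this.1, this.2.trans ih.2⟩

lemma TminusB_pos {aB wB : ℝ} (haB : 0 < aB) (hwB : 0 < wB) {π : P → ℝ}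
    (hπ : ∀ p, 0 < π p) (p : P) : 0 < TminusB aB wB p π :=
  one_div_pos.2 (mul_pos (hπ p) (aboveInvSum_pos haB hwB hπ p))

lemma TplusB_eq {aB wB : ℝ} (haB : 0 < aB) (hwB : 0 < wB)
    (e : Fin (Fintype.card P) ≃ P) (he : IsLinearExtension e) {π : P → ℝ}
    (hπ : ∀ p, 0 < π p) (p : P) :
    TplusB aB wB p π = TminusB aB wB p (brho aB wB e π) := by
  have h1 := belowSum_pos haB hwB hπ p
  have h0 := (brho_inv haB hwB e hπ 1).1
  have h2 : 0 < aboveInvSum aB wB (brho aB wB e π) p := aboveInvSum_pos haB hwB h0 p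
  have h3 := hπ p
  rw [TplusB, TminusB, brho_apply aB wB e he π p]
  field_simp

lemma prod_TB {aB wB : ℝ} (haB : 0 < aB) (hwB : 0 < wB)
    (e : Fin (Fintype.card P) ≃ P) (he : IsLinearExtension e) {π : P → ℝ}
    (hπ : ∀ p, 0 < π p) (p : P) (n : ℕ) :
    ∏ i ∈ Finset.range n, TB aB wB p ((brho aB wB e)^[i] π) =
      TminusB aB wB p ((brho aB wB e)^[n] π) / TminusB aB wB p π := by
  induction n with
  | zero => simp [(TminusB_pos haB hwB hπ p).ne']
  | succ n ih =>
    have h := (brho_inv haB hwB e hπ n).1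
    have h1 := TminusB_pos haB hwB h p
    have h2 := TminusB_pos haB hwB hπ p
    rw [Finset.prod_range_succ, ih, Function.iterate_succ_apply', TB,
      TplusB_eq haB hwB e he h]
    field_simp

lemma TminusB_bounds {aB wB : ℝ} (haB : 0 < aB) (hwB : 0 < wB) (W : ℝ) (hW : 0 < W) (p : P) :
    ∃ c C : ℝ, 0 < c ∧ ∀ π : P → ℝ, (∀ p, 0 < π p) → superpot aB wB π = W →
      c ≤ TminusB aB wB p π ∧ TminusB aB wB p π ≤ C := by
  obtain ⟨s, hs⟩ := exists_above _ (toHat_ne_top p)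
  obtain ⟨C, hC, hC'⟩ := exists_upper haB hwB W hW s
  obtain ⟨c, hc, hc'⟩ := exists_lower haB hwB W hW (toHat p)
  refine ⟨1 / W, C / c, one_div_pos.2 hW, fun π hπ hw => ⟨?_, ?_⟩⟩
  · refine one_div_le_one_div_of_le (mul_pos (hπ p) (aboveInvSum_pos haB hwB hπ p)) ?_
    have h1 := superpot_split aB wB π p
    have h2 := div_pos (belowSum_pos haB hwB hπ p) (hπ p)
    have h3 : 0 ≤ ∑ x ∈ Finset.univ.erase (toHat p), ∑ y ∈ Finset.univ.erase (toHat p),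
        if x ⋖ y then extLab aB wB π x / extLab aB wB π y else 0 := by
      refine Finset.sum_nonneg fun x _ => Finset.sum_nonneg fun y _ => ?_
      split_ifs
      · exact (div_pos (extLab_pos haB hwB hπ x) (extLab_pos haB hwB hπ y)).le
      · exact le_rfl
    linarith
  · have hcp : c ≤ π p := hc' π hπ hw
    have hA : 1 / C ≤ aboveInvSum aB wB π p := by
      have hx := extLab_pos haB hwB hπ s
      have h1 : 1 / C ≤ (extLab aB wB π s)⁻¹ := by
        rw [← one_div]
        exact one_div_le_one_div_of_le hx (hC' π hπ hw)
      refine h1.trans ?_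
      rw [aboveInvSum_eq]
      have := Finset.single_le_sum
        (f := fun r => if toHat p ⋖ r then (extLab aB wB π r)⁻¹ else 0)
        (fun r _ => by
          show 0 ≤ if toHat p ⋖ r then (extLab aB wB π r)⁻¹ else 0
          split_ifs
          · exact (inv_pos.2 (extLab_pos haB hwB hπ r)).le
          · exact le_rfl) (Finset.mem_univ s)
      simpa only [if_pos hs] using this
    have h2 : c * (1 / C) ≤ π p * aboveInvSum aB wB π p :=
      mul_le_mul hcp hA (one_div_pos.2 hC).le (hπ p).le
    have h3 := one_div_le_one_div_of_le (mul_pos hc (one_div_pos.2 hC)) h2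
    refine h3.trans (le_of_eq ?_)
    field_simp

lemma tendsto_rpow_inv_of_bounds (a : ℕ → ℝ) (c C : ℝ) (hc : 0 < c)
    (h1 : ∀ n, c ≤ a n) (h2 : ∀ n, a n ≤ C) :
    Filter.Tendsto (fun n : ℕ => a n ^ ((n : ℝ)⁻¹)) Filter.atTop (nhds 1) := by
  have key : ∀ b : ℝ, 0 < b →
      Filter.Tendsto (fun n : ℕ => b ^ ((n : ℝ)⁻¹)) Filter.atTop (nhds 1) := by
    intro b hb
    have h := (Real.continuousAt_const_rpow hb.ne' (b := 0)).tendsto.comp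
      (tendsto_inv_atTop_nhds_zero_nat (𝕜 := ℝ))
    simpa [Function.comp_def] using h
  have hC : 0 < C := hc.trans_le ((h1 0).trans (h2 0))
  refine tendsto_of_tendsto_of_tendsto_of_le_of_le (key c hc) (key C hC) ?_ ?_
  · intro n
    exact Real.rpow_le_rpow hc.le (h1 n) (by positivity)
  · intro n
    exact Real.rpow_le_rpow (hc.le.trans (h1 n)) (h2 n) (by positivity)

/-- Lemma `bi togg 1mesic`.
For a finite poset `P`, positive parameters, a linear extension, a positive labeling `π`
and `p ∈ P`, the birational toggleability statistic `T_p^B` is multiplicatively 1-mesic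
along the `ρ^B`-orbit of `π`:
`lim_{n→∞} (∏_{i=0}^{n−1} T_p^B((ρ^B)^i(π)))^{1/n} = 1`. -/
theorem statement18 {P : Type*} [PartialOrder P] [Fintype P]
    (aB wB : ℝ) (haB : 0 < aB) (hwB : 0 < wB)
    (e : Fin (Fintype.card P) ≃ P) (he : IsLinearExtension e)
    (π : P → ℝ) (hπ : ∀ p, 0 < π p) (p : P) :
    Filter.Tendsto
      (fun n : ℕ =>
        (∏ i ∈ Finset.range n, TB aB wB p ((brho aB wB e)^[i] π)) ^ ((n : ℝ)⁻¹))
      Filter.atTop (nhds 1) := by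
  obtain ⟨c, C, hc, h⟩ := TminusB_bounds haB hwB _ (superpot_pos haB hwB hπ p) p
  have h0 := TminusB_pos haB hwB hπ p
  simp only [prod_TB haB hwB e he hπ p]
  have hb := fun n => h _ (brho_inv haB hwB e hπ n).1 (brho_inv haB hwB e hπ n).2
  exact tendsto_rpow_inv_of_bounds _ (c / TminusB aB wB p π) (C / TminusB aB wB p π)
    (div_pos hc h0) (fun n => div_le_div_of_nonneg_right (hb n).1 h0.le)
    (fun n => div_le_div_of_nonneg_right (hb n).2 h0.le)

end Birational
end

section
/- Let F = F̆(α_1,…,α_t) be a fence. Let I_H(F) be the space of statistics in the ℝ-span of {χ̂_p : p ∈ F} that are homomesic under rowmotion, and let A_H(F) be the space of statistics in the ℝ-span of {χ_p : p ∈ F} that are homomesic under rowmotion. Then dim I_H(F) = dim A_H(F). -/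
open scoped Classical

namespace Fence

/-- partial sums: `m α i = α 0 + ⋯ + α (i-1)` (the paper's `m_i`). -/
def m (α : ℕ → ℕ) (i : ℕ) : ℕ := ∑ k ∈ Finset.range i, α k

/-- the number `n` of elements of the fence `F̆(α)`. -/
def nn (t : ℕ) (α : ℕ → ℕ) : ℕ := m α t - 1

/-- vertex type: index `0` is a dummy (used as sentinel for nonexistent elements);
the fence elements are the indices `1,…,nn t α`. -/
abbrev V (t : ℕ) (α : ℕ → ℕ) := Fin (nn t α + 1)

/-- the element `x_j` (1-based). -/
def xel (t : ℕ) (α : ℕ → ℕ) (j : ℕ) : V t α :=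
  ⟨j % (nn t α + 1), Nat.mod_lt _ (Nat.succ_pos _)⟩

/-- `p` is an actual element of the fence (not the dummy `0`). -/
def Elem (t : ℕ) (α : ℕ → ℕ) (p : V t α) : Prop := 1 ≤ (p : ℕ)

/-- the conditions on `(t, α)` for `F̆(α)` to be a fence. -/
def IsFence (t : ℕ) (α : ℕ → ℕ) : Prop :=
  2 ≤ t ∧ (∀ i < t, 1 ≤ α i) ∧ 2 ≤ α 0 ∧ 2 ≤ α (t - 1)

/-- the covering relation of the fence: `Cov t α a b` means `a ⋖ b`. -/
def Cov (t : ℕ) (α : ℕ → ℕ) (a b : V t α) : Prop :=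
  ∃ i < t, ((i % 2 = 0 ∧ (b : ℕ) = (a : ℕ) + 1) ∨ (i % 2 = 1 ∧ (a : ℕ) = (b : ℕ) + 1)) ∧
    m α i ≤ min (a : ℕ) (b : ℕ) ∧ min (a : ℕ) (b : ℕ) < m α (i + 1) ∧
    1 ≤ min (a : ℕ) (b : ℕ) ∧ max (a : ℕ) (b : ℕ) ≤ nn t α

/-- the order of the fence: reflexive–transitive closure of the covering relation. -/
def Le (t : ℕ) (α : ℕ → ℕ) : V t α → V t α → Prop := Relation.ReflTransGen (Cov t α)

/-- order ideals of the fence (as sets of actual elements, downward closed). -/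
def IsIdeal (t : ℕ) (α : ℕ → ℕ) (I : Set (V t α)) : Prop :=
  (∀ p ∈ I, Elem t α p) ∧ ∀ a b : V t α, Le t α a b → b ∈ I → a ∈ I

/-- `J t α` is the set of order ideals of the fence. -/
abbrev J (t : ℕ) (α : ℕ → ℕ) := {I : Set (V t α) // IsIdeal t α I}

/-- `p` is a maximal element of the set `I`. -/
def MaxIn (t : ℕ) (α : ℕ → ℕ) (I : Set (V t α)) (p : V t α) : Prop :=
  p ∈ I ∧ ∀ q ∈ I, Le t α p q → q = p

/-- `p` is a minimal element of the complement of `I` (among actual elements). -/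
def MinOut (t : ℕ) (α : ℕ → ℕ) (I : Set (V t α)) (p : V t α) : Prop :=
  Elem t α p ∧ p ∉ I ∧ ∀ q : V t α, Elem t α q → q ∉ I → Le t α q p → q = p

/-- the order-ideal indicator function `χ̂_p`. -/
noncomputable def chiHat (t : ℕ) (α : ℕ → ℕ) (p : V t α) (I : J t α) : ℝ :=
  if p ∈ I.1 then 1 else 0

/-- the antichain indicator function `χ_p`. -/
noncomputable def chi (t : ℕ) (α : ℕ → ℕ) (p : V t α) (I : J t α) : ℝ :=
  if MaxIn t α I.1 p then 1 else 0

/-- the toggleability statistic `T_p`. -/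
noncomputable def Tg (t : ℕ) (α : ℕ → ℕ) (p : V t α) (I : J t α) : ℝ :=
  if MinOut t α I.1 p then 1 else if MaxIn t α I.1 p then -1 else 0

/-- the antichain toggleability statistic `T_A`. -/
noncomputable def TA (t : ℕ) (α : ℕ → ℕ) (A : Set (V t α)) (I : J t α) : ℝ :=
  if ∀ p ∈ A, MinOut t α I.1 p then 1 else if ∀ p ∈ A, MaxIn t α I.1 p then -1 else 0

/-- `#[a,b]`: the number of elements `r` with `a ⊴ r ⊴ b`. -/
noncomputable def icard (t : ℕ) (α : ℕ → ℕ) (a b : V t α) : ℕ :=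
  Set.ncard {r : V t α | Elem t α r ∧ Le t α a r ∧ Le t α r b}

/-- the span of the toggleability statistics `{T_p : p ∈ F}`. -/
noncomputable def ToggSpan (t : ℕ) (α : ℕ → ℕ) : Submodule ℝ (J t α → ℝ) :=
  Submodule.span ℝ {f | ∃ p : V t α, Elem t α p ∧ f = Tg t α p}

/-- `f ≡ g`: `f - g` is an `ℝ`-linear combination of toggleability statistics. -/
def Equiv' (t : ℕ) (α : ℕ → ℕ) (f g : J t α → ℝ) : Prop := f - g ∈ ToggSpan t α

/-- statistics of the form `const + linear combination of toggleability statistics`. -/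
noncomputable def ConstPlusTogg (t : ℕ) (α : ℕ → ℕ) : Submodule ℝ (J t α → ℝ) :=
  ToggSpan t α ⊔ Submodule.span ℝ {fun _ : J t α => (1 : ℝ)}

/-- the span of the antichain indicator functions `{χ_p : p ∈ F}`. -/
noncomputable def chiSpan (t : ℕ) (α : ℕ → ℕ) : Submodule ℝ (J t α → ℝ) :=
  Submodule.span ℝ {f | ∃ p : V t α, Elem t α p ∧ f = chi t α p}

/-- the span of the order-ideal indicator functions `{χ̂_p : p ∈ F}`. -/
noncomputable def chiHatSpan (t : ℕ) (α : ℕ → ℕ) : Submodule ℝ (J t α → ℝ) :=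
  Submodule.span ℝ {f | ∃ p : V t α, Elem t α p ∧ f = chiHat t α p}

/-- the antichain toggleability space `A_T(F)`. -/
noncomputable def AT (t : ℕ) (α : ℕ → ℕ) : Submodule ℝ (J t α → ℝ) :=
  chiSpan t α ⊓ ConstPlusTogg t α

/-- the order ideal toggleability space `I_T(F)`. -/
noncomputable def IT (t : ℕ) (α : ℕ → ℕ) : Submodule ℝ (J t α → ℝ) :=
  chiHatSpan t α ⊓ ConstPlusTogg t α

/-- the shared element `s_i = x_{m_i}` (for `1 ≤ i ≤ t-1`); the sentinels `i = 0` and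
`i = t` give the dummy vertex `0`, so statistics indexed by them vanish. -/
def sElx (t : ℕ) (α : ℕ → ℕ) (i : ℕ) : V t α := xel t α (m α i)

/-- 1-based index of the unshared element `s_{(i,j)}` (the `j`-th smallest unshared
element of the segment `S_i`, in the order of the fence). -/
def uEl (α : ℕ → ℕ) (i j : ℕ) : ℕ :=
  if (i - 1) % 2 = 0 then m α (i - 1) + j else m α i - j

def uElx (t : ℕ) (α : ℕ → ℕ) (i j : ℕ) : V t α := xel t α (uEl α i j)

/-- 1-based index of the peak of segment `S_i` (sentinel `0` if it does not exist). -/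
def peakN (t : ℕ) (α : ℕ → ℕ) (i : ℕ) : ℕ :=
  if i % 2 = 1 then (if i + 1 ≤ t then m α i else 0) else m α (i - 1)

/-- 1-based index of the valley of segment `S_i` (sentinel `0` if it does not exist). -/
def valleyN (t : ℕ) (α : ℕ → ℕ) (i : ℕ) : ℕ :=
  if i % 2 = 1 then (if 2 ≤ i then m α (i - 1) else 0) else (if i + 1 ≤ t then m α i else 0)

def peakx (t : ℕ) (α : ℕ → ℕ) (i : ℕ) : V t α := xel t α (peakN t α i)
def valleyx (t : ℕ) (α : ℕ → ℕ) (i : ℕ) : V t α := xel t α (valleyN t α i)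

/-- segment `S_i` has a peak. -/
def HasPeak (t i : ℕ) : Prop := i % 2 = 0 ∨ i + 1 ≤ t

/-- segment `S_i` has a valley. -/
def HasValley (t i : ℕ) : Prop := (i % 2 = 1 ∧ 2 ≤ i) ∨ (i % 2 = 0 ∧ i + 1 ≤ t)

/-- `p` is a shared element of the fence. -/
def IsSharedElem (t : ℕ) (α : ℕ → ℕ) (p : V t α) : Prop :=
  ∃ i, 1 ≤ i ∧ i + 1 ≤ t ∧ p = sElx t α i

/-- `p` is a peak of the fence. -/
def IsPeakElem (t : ℕ) (α : ℕ → ℕ) (p : V t α) : Prop :=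
  ∃ i, 1 ≤ i ∧ i + 1 ≤ t ∧ i % 2 = 1 ∧ p = sElx t α i

/-- span of the antichain indicators of the shared elements. -/
noncomputable def chiSharedSpan (t : ℕ) (α : ℕ → ℕ) : Submodule ℝ (J t α → ℝ) :=
  Submodule.span ℝ {f | ∃ i, 1 ≤ i ∧ i + 1 ≤ t ∧ f = chi t α (sElx t α i)}

/-- span of the order-ideal indicators of the shared elements. -/
noncomputable def chiHatSharedSpan (t : ℕ) (α : ℕ → ℕ) : Submodule ℝ (J t α → ℝ) :=
  Submodule.span ℝ {f | ∃ i, 1 ≤ i ∧ i + 1 ≤ t ∧ f = chiHat t α (sElx t α i)}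

theorem cov_elem {t : ℕ} {α : ℕ → ℕ} {a b : V t α} (h : Cov t α a b) :
    Elem t α a ∧ Elem t α b := by
  obtain ⟨i, hi, hd, h1, h2, h3, h4⟩ := h
  constructor <;> (simp only [Elem]; omega)

theorem le_elem {t : ℕ} {α : ℕ → ℕ} {a b : V t α} (h : Le t α a b) (hb : Elem t α b) :
    Elem t α a := by
  induction h using Relation.ReflTransGen.head_induction_on with
  | refl => exact hb
  | head hc _ _ => exact (cov_elem hc).1

/-- rowmotion: `ρ(I)` is the order ideal generated by the minimal elements of the
complement of `I`. -/
noncomputable def rho (t : ℕ) (α : ℕ → ℕ) (I : J t α) : J t α :=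
  ⟨{q | ∃ p : V t α, MinOut t α I.1 p ∧ Le t α q p}, by
    constructor
    · rintro q ⟨p, hp, hle⟩
      exact le_elem hle hp.1
    · rintro a b hab ⟨p, hp, hle⟩
      exact ⟨p, hp, Relation.ReflTransGen.trans hab hle⟩⟩

/-- the (forward) orbit of `x` under `ρ`. -/
def orbit {X : Type*} (ρ : X → X) (x : X) : Set X := {y | ∃ k : ℕ, ρ^[k] x = y}

/-- `f` is `c`-mesic under `ρ`: the sum of `f` over each orbit is `c` times
the orbit size. -/
def IsMesic {X : Type*} (ρ : X → X) (f : X → ℝ) (c : ℝ) : Prop :=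
  ∀ x : X, ∑ᶠ y ∈ orbit ρ x, f y = (orbit ρ x).ncard * c


/-- the subspace of statistics that are homomesic under rowmotion. -/
noncomputable def Homomesic (t : ℕ) (α : ℕ → ℕ) : Submodule ℝ (J t α → ℝ) where
  carrier := {f | ∃ c : ℝ, IsMesic (rho t α) f c}
  zero_mem' := ⟨0, fun x => by simp [IsMesic]⟩
  add_mem' := by
    rintro f g ⟨cf, hf⟩ ⟨cg, hg⟩
    refine ⟨cf + cg, fun x => ?_⟩
    have hfin : (orbit (rho t α) x).Finite := Set.toFinite _
    have hsplit : ∑ᶠ y ∈ orbit (rho t α) x, (f + g) y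
        = (∑ᶠ y ∈ orbit (rho t α) x, f y) + ∑ᶠ y ∈ orbit (rho t α) x, g y := by
      simpa using finsum_mem_add_distrib hfin (f := f) (g := g)
    rw [hsplit, hf x, hg x]; ring
  smul_mem' := by
    rintro r f ⟨c, hf⟩
    refine ⟨r * c, fun x => ?_⟩
    have hfin : (orbit (rho t α) x).Finite := Set.toFinite _
    have hmul : ∑ᶠ y ∈ orbit (rho t α) x, (r • f) y
        = r * ∑ᶠ y ∈ orbit (rho t α) x, f y := by
      rw [finsum_mem_eq_finite_toFinset_sum _ hfin, finsum_mem_eq_finite_toFinset_sum _ hfin,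
        Finset.mul_sum]
      simp [smul_eq_mul]
    rw [hmul, hf x]; ring

/-- orientation of the `k`-th step of the fence. -/
noncomputable def stepSgn (t : ℕ) (α : ℕ → ℕ) (k : ℕ) : ℤ :=
  if ∃ i < t, i % 2 = 0 ∧ m α i ≤ k ∧ k < m α (i + 1) then 1 else -1

/-- a height function that is strictly increasing along covers. -/
noncomputable def ht (t : ℕ) (α : ℕ → ℕ) (p : V t α) : ℤ :=
  ∑ k ∈ Finset.range (p : ℕ), stepSgn t α k

theorem m_mono (α : ℕ → ℕ) : Monotone (m α) := by
  intro a b h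
  exact Finset.sum_le_sum_of_subset (Finset.range_subset_range.2 h)

theorem ht_cov {t : ℕ} {α : ℕ → ℕ} {a b : V t α} (h : Cov t α a b) :
    ht t α b = ht t α a + 1 := by
  obtain ⟨i, hi, hd, h1, h2, -, -⟩ := h
  rcases hd with ⟨he, hab⟩ | ⟨ho, hab⟩
  · have hm : min (a : ℕ) (b : ℕ) = a := by omega
    rw [hm] at h1 h2
    have hs : stepSgn t α a = 1 := if_pos ⟨i, hi, he, h1, h2⟩
    simp only [ht, hab, Finset.sum_range_succ, hs]
  · have hm : min (a : ℕ) (b : ℕ) = b := by omega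
    rw [hm] at h1 h2
    have hs : stepSgn t α b = -1 := by
      apply if_neg
      rintro ⟨i', hi', he', h1', h2'⟩
      rcases lt_trichotomy i i' with hlt | heq | hgt
      · have := m_mono α (show i + 1 ≤ i' by omega)
        omega
      · omega
      · have := m_mono α (show i' + 1 ≤ i by omega)
        omega
    simp only [ht, hab, Finset.sum_range_succ, hs]
    ring

theorem cov_nbr {t : ℕ} {α : ℕ → ℕ} {a b : V t α} (h : Cov t α a b) :
    (b : ℕ) = a + 1 ∨ (a : ℕ) = b + 1 := by
  obtain ⟨i, hi, hd, -⟩ := h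
  omega

theorem le_ht {t : ℕ} {α : ℕ → ℕ} {a b : V t α} (h : Le t α a b) :
    a = b ∨ ht t α a < ht t α b := by
  induction h with
  | refl => exact Or.inl rfl
  | tail _ hc ih =>
    right
    have := ht_cov hc
    rcases ih with rfl | ih <;> omega

theorem le_antisymm' {t : ℕ} {α : ℕ → ℕ} {a b : V t α} (h : Le t α a b) (h' : Le t α b a) :
    a = b := by
  rcases le_ht h with h1 | h1
  · exact h1
  · rcases le_ht h' with h2 | h2
    · exact h2.symm
    · omega

theorem wf_up (t : ℕ) (α : ℕ → ℕ) : WellFounded (fun a b : V t α => ht t α b < ht t α a) :=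
  @Finite.wellFounded_of_trans_of_irrefl _ _ _ ⟨fun _ _ _ h h' => lt_trans h' h⟩
    ⟨fun _ => lt_irrefl _⟩

theorem wf_down (t : ℕ) (α : ℕ → ℕ) : WellFounded (fun a b : V t α => ht t α a < ht t α b) :=
  @Finite.wellFounded_of_trans_of_irrefl _ _ _ ⟨fun _ _ _ h h' => lt_trans h h'⟩
    ⟨fun _ => lt_irrefl _⟩

theorem maxIn_rho {t : ℕ} {α : ℕ → ℕ} (I : J t α) (p : V t α) :
    MaxIn t α (rho t α I).1 p ↔ MinOut t α I.1 p := by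
  constructor
  · rintro ⟨⟨p', hp', hle⟩, hmax⟩
    have : p' = p := hmax p' ⟨p', hp', Relation.ReflTransGen.refl⟩ hle
    exact this ▸ hp'
  · intro hp
    refine ⟨⟨p, hp, Relation.ReflTransGen.refl⟩, ?_⟩
    rintro q ⟨p', hp', hle⟩ hpq
    have : p = p' := hp'.2.2 p hp.1 hp.2.1 (Relation.ReflTransGen.trans hpq hle)
    subst this
    exact le_antisymm' hle hpq

theorem exists_minOut {t : ℕ} {α : ℕ → ℕ} (I : J t α) (x : V t α) :
    Elem t α x → x ∉ I.1 → ∃ p, MinOut t α I.1 p ∧ Le t α p x := by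
  induction x using (wf_down t α).induction with
  | _ x ih =>
    intro hx hxI
    by_cases hm : MinOut t α I.1 x
    · exact ⟨x, hm, Relation.ReflTransGen.refl⟩
    · have : ∃ q, Elem t α q ∧ q ∉ I.1 ∧ Le t α q x ∧ q ≠ x := by
        by_contra hc
        push Not at hc
        exact hm ⟨hx, hxI, hc⟩
      obtain ⟨q, hq, hqI, hle, hne⟩ := this
      obtain ⟨p, hp, hpq⟩ := ih q ((le_ht hle).resolve_left hne) hq hqI
      exact ⟨p, hp, Relation.ReflTransGen.trans hpq hle⟩

theorem notMem_iff {t : ℕ} {α : ℕ → ℕ} (I : J t α) (x : V t α) :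
    x ∈ I.1 ↔ Elem t α x ∧ ¬ ∃ p, MaxIn t α (rho t α I).1 p ∧ Le t α p x := by
  constructor
  · intro hx
    refine ⟨I.2.1 x hx, ?_⟩
    rintro ⟨p, hp, hle⟩
    exact ((maxIn_rho I p).1 hp).2.1 (I.2.2 p x hle hx)
  · rintro ⟨hx, hn⟩
    by_contra hxI
    obtain ⟨p, hp, hle⟩ := exists_minOut I x hx hxI
    exact hn ⟨p, (maxIn_rho I p).2 hp, hle⟩

theorem rho_injective (t : ℕ) (α : ℕ → ℕ) : Function.Injective (rho t α) := by
  intro I I' h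
  apply Subtype.ext
  ext x
  rw [notMem_iff, notMem_iff, h]

theorem comp_sub_mem (t : ℕ) (α : ℕ → ℕ) (f : J t α → ℝ) :
    (fun I => f (rho t α I) - f I) ∈ Homomesic t α := by
  refine ⟨0, fun x => ?_⟩
  have hfin : (orbit (rho t α) x).Finite := Set.toFinite _
  have himg : rho t α '' orbit (rho t α) x = orbit (rho t α) x := by
    apply Set.eq_of_subset_of_ncard_le _ _ hfin
    · rintro _ ⟨_, ⟨k, rfl⟩, rfl⟩
      exact ⟨k + 1, Function.iterate_succ_apply' _ _ _⟩
    · rw [Set.ncard_image_of_injective _ (rho_injective t α)]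
  have h1 : ∑ᶠ y ∈ orbit (rho t α) x, f (rho t α y) = ∑ᶠ y ∈ orbit (rho t α) x, f y := by
    conv_rhs => rw [← himg]
    rw [finsum_mem_image (rho_injective t α).injOn]
  beta_reduce
  rw [finsum_mem_sub_distrib (fun y => f (rho t α y)) f hfin, h1]
  simp

theorem one_mem (t : ℕ) (α : ℕ → ℕ) : (fun _ => (1 : ℝ)) ∈ Homomesic t α := by
  refine ⟨1, fun x => ?_⟩
  have hfin : (orbit (rho t α) x).Finite := Set.toFinite _
  rw [finsum_mem_eq_finite_toFinset_sum _ hfin, Set.ncard_eq_toFinset_card _ hfin]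
  simp

/-- If `p` has no lower cover, then `χ_p + χ̂_p` is homomesic. -/
theorem chi_min {t : ℕ} {α : ℕ → ℕ} {p : V t α} (hp : Elem t α p)
    (hmin : ∀ a, ¬ Cov t α a p) : chi t α p + chiHat t α p ∈ Homomesic t α := by
  have h1 : chi t α p + chiHat t α p =
      (fun _ => (1 : ℝ)) - (fun I => chi t α p (rho t α I) - chi t α p I) := by
    funext I
    have h2 : MinOut t α I.1 p ↔ p ∉ I.1 := by
      constructor
      · exact fun h => h.2.1
      · intro h
        refine ⟨hp, h, fun q _ _ hle => ?_⟩
        rcases Relation.ReflTransGen.cases_tail hle with h | ⟨c, -, hc⟩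
        · exact h.symm
        · exact (hmin c hc).elim
    have h3 : chi t α p (rho t α I) = 1 - chiHat t α p I := by
      unfold chi chiHat
      rw [maxIn_rho, h2]
      by_cases h : p ∈ I.1 <;> simp [h]
    simp only [Pi.add_apply, Pi.sub_apply, h3]
    ring
  rw [h1]
  exact Submodule.sub_mem _ (one_mem t α) (comp_sub_mem t α _)

/-- no upper cover. -/
theorem chi_top {t : ℕ} {α : ℕ → ℕ} {p : V t α} (h : ∀ r, ¬ Cov t α p r) :
    chi t α p = chiHat t α p := by
  funext I
  have : MaxIn t α I.1 p ↔ p ∈ I.1 := by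
    refine ⟨fun h => h.1, fun hp => ⟨hp, fun q _ hle => ?_⟩⟩
    rcases Relation.ReflTransGen.cases_head hle with h' | ⟨c, hc, -⟩
    · exact h'.symm
    · exact (h c hc).elim
  simp only [chi, chiHat, this]

/-- exactly one upper cover. -/
theorem chi_mid {t : ℕ} {α : ℕ → ℕ} {p r : V t α} (hr : Cov t α p r)
    (h : ∀ r', Cov t α p r' → r' = r) :
    chi t α p = chiHat t α p - chiHat t α r := by
  funext I
  have h1 : MaxIn t α I.1 p ↔ p ∈ I.1 ∧ r ∉ I.1 := by
    constructor
    · rintro ⟨hp, hm⟩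
      refine ⟨hp, fun hrI => ?_⟩
      have := hm r hrI (Relation.ReflTransGen.single hr)
      have h2 := ht_cov hr
      rw [this] at h2
      omega
    · rintro ⟨hp, hrI⟩
      refine ⟨hp, fun q hq hle => ?_⟩
      rcases Relation.ReflTransGen.cases_head hle with h' | ⟨c, hc, hcq⟩
      · exact h'.symm
      · rw [h c hc] at hcq
        exact (hrI (I.2.2 r q hcq hq)).elim
  have h2 : r ∈ I.1 → p ∈ I.1 := I.2.2 p r (Relation.ReflTransGen.single hr)
  simp only [chi, chiHat, h1, Pi.sub_apply]
  by_cases hr : r ∈ I.1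
  · simp [hr, h2 hr]
  · simp [hr]

theorem trich {t : ℕ} {α : ℕ → ℕ} (p : V t α) :
    (∀ a, ¬ Cov t α a p) ∨ (∀ r, ¬ Cov t α p r) ∨
      ∃ r, Cov t α p r ∧ ∀ r', Cov t α p r' → r' = r := by
  by_contra hc
  push Not at hc
  obtain ⟨⟨a, ha⟩, ⟨r, hr⟩, h⟩ := hc
  obtain ⟨r', hr', hne⟩ := h r hr
  have h1 := ht_cov ha
  have h2 := ht_cov hr
  have h3 := ht_cov hr'
  have n1 := cov_nbr ha
  have n2 := cov_nbr hr
  have n3 := cov_nbr hr'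
  have e1 : a ≠ r := by rintro rfl; omega
  have e2 : a ≠ r' := by rintro rfl; omega
  have e1' : (a : ℕ) ≠ r := fun h => e1 (Fin.ext h)
  have e2' : (a : ℕ) ≠ r' := fun h => e2 (Fin.ext h)
  have e3' : (r' : ℕ) ≠ r := fun h => hne (Fin.ext h)
  omega

theorem chi_mem {t : ℕ} {α : ℕ → ℕ} {p : V t α} (hp : Elem t α p) :
    chi t α p ∈ chiSpan t α := Submodule.subset_span ⟨p, hp, rfl⟩

theorem chiHat_mem {t : ℕ} {α : ℕ → ℕ} {p : V t α} (hp : Elem t α p) :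
    chiHat t α p ∈ chiHatSpan t α := Submodule.subset_span ⟨p, hp, rfl⟩

theorem chi_mem_sup {t : ℕ} {α : ℕ → ℕ} (p : V t α) (hp : Elem t α p) :
    chi t α p ∈ chiHatSpan t α ⊔ Homomesic t α := by
  have hp' : chiHat t α p ∈ chiHatSpan t α ⊔ Homomesic t α :=
    Submodule.mem_sup_left (chiHat_mem hp)
  rcases trich p with h | h | ⟨r, hr, h⟩
  · have := Submodule.sub_mem _ (Submodule.mem_sup_right (chi_min hp h)) hp'
    rwa [add_sub_cancel_right] at this
  · rwa [chi_top h]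
  · rw [chi_mid hr h]
    exact Submodule.sub_mem _ hp' (Submodule.mem_sup_left (chiHat_mem (cov_elem hr).2))

theorem chiHat_mem_sup {t : ℕ} {α : ℕ → ℕ} (p : V t α) :
    Elem t α p → chiHat t α p ∈ chiSpan t α ⊔ Homomesic t α := by
  induction p using (wf_up t α).induction with
  | _ p ih =>
    intro hp
    have hp' : chi t α p ∈ chiSpan t α ⊔ Homomesic t α :=
      Submodule.mem_sup_left (chi_mem hp)
    rcases trich p with h | h | ⟨r, hr, h⟩
    · have := Submodule.sub_mem _ (Submodule.mem_sup_right (chi_min hp h)) hp'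
      rwa [add_sub_cancel_left] at this
    · rwa [← chi_top h]
    · have h1 := ih r (by have := ht_cov hr; omega) (cov_elem hr).2
      have := Submodule.add_mem _ hp' h1
      rwa [chi_mid hr h, sub_add_cancel] at this

theorem sup_eq (t : ℕ) (α : ℕ → ℕ) :
    chiHatSpan t α ⊔ Homomesic t α = chiSpan t α ⊔ Homomesic t α := by
  apply le_antisymm
  · refine sup_le (Submodule.span_le.2 ?_) le_sup_right
    rintro _ ⟨p, hp, rfl⟩
    exact chiHat_mem_sup p hp
  · refine sup_le (Submodule.span_le.2 ?_) le_sup_right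
    rintro _ ⟨p, hp, rfl⟩
    exact chi_mem_sup p hp

/-- the principal ideal. -/
def princ {t : ℕ} {α : ℕ → ℕ} (p : V t α) (hp : Elem t α p) : J t α :=
  ⟨{q | Le t α q p}, fun _ hq => le_elem hq hp,
    fun _ _ hab hb => Relation.ReflTransGen.trans hab hb⟩

/-- the principal ideal without its top. -/
def princ' {t : ℕ} {α : ℕ → ℕ} (p : V t α) (hp : Elem t α p) : J t α :=
  ⟨{q | Le t α q p ∧ q ≠ p}, fun _ hq => le_elem hq.1 hp, by
    rintro a b hab ⟨hb, hne⟩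
    refine ⟨Relation.ReflTransGen.trans hab hb, ?_⟩
    rintro rfl
    exact hne (le_antisymm' hb hab)⟩

theorem linInd_chi (t : ℕ) (α : ℕ → ℕ) :
    LinearIndependent ℝ (fun p : {p : V t α // Elem t α p} => chi t α p.1) := by
  rw [Fintype.linearIndependent_iff]
  intro g hg p
  have h := congrFun hg (princ p.1 p.2)
  rw [Finset.sum_apply, Finset.sum_eq_single p] at h
  · have h1 : MaxIn t α (princ p.1 p.2).1 p.1 :=
      ⟨Relation.ReflTransGen.refl, fun q hq hle => le_antisymm' hq hle⟩
    simpa [chi, h1] using h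
  · intro q _ hne
    have h1 : ¬ MaxIn t α (princ p.1 p.2).1 q.1 := by
      rintro ⟨hq, hm⟩
      exact hne (Subtype.ext (hm p.1 Relation.ReflTransGen.refl hq).symm)
    simp [chi, h1]
  · simp

theorem linInd_chiHat (t : ℕ) (α : ℕ → ℕ) :
    LinearIndependent ℝ (fun p : {p : V t α // Elem t α p} => chiHat t α p.1) := by
  rw [Fintype.linearIndependent_iff]
  intro g hg p
  have h1 := congrFun hg (princ p.1 p.2)
  have h2 := congrFun hg (princ' p.1 p.2)
  have h : ∑ q, (g q * chiHat t α q.1 (princ p.1 p.2) - g q * chiHat t α q.1 (princ' p.1 p.2))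
      = 0 := by
    rw [Finset.sum_sub_distrib]
    simp only [Finset.sum_apply, Pi.smul_apply, smul_eq_mul, Pi.zero_apply] at h1 h2
    rw [h1, h2, sub_zero]
  rw [Finset.sum_eq_single p] at h
  · have e1 : p.1 ∈ (princ p.1 p.2).1 := Relation.ReflTransGen.refl
    have e2 : p.1 ∉ (princ' p.1 p.2).1 := fun h => h.2 rfl
    simpa [chiHat, e1, e2] using h
  · intro q _ hne
    have e : q.1 ∈ (princ' p.1 p.2).1 ↔ q.1 ∈ (princ p.1 p.2).1 :=
      ⟨fun h => h.1, fun h => ⟨h, fun h' => hne (Subtype.ext h')⟩⟩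
    simp [chiHat, e]
  · simp

theorem finrank_spans (t : ℕ) (α : ℕ → ℕ) :
    Module.finrank ℝ (chiHatSpan t α) = Module.finrank ℝ (chiSpan t α) := by
  have e1 : {f | ∃ p : V t α, Elem t α p ∧ f = chiHat t α p} =
      Set.range (fun p : {p : V t α // Elem t α p} => chiHat t α p.1) := by
    ext f
    constructor
    · rintro ⟨p, hp, rfl⟩
      exact ⟨⟨p, hp⟩, rfl⟩
    · rintro ⟨p, rfl⟩
      exact ⟨p.1, p.2, rfl⟩
  have e2 : {f | ∃ p : V t α, Elem t α p ∧ f = chi t α p} =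
      Set.range (fun p : {p : V t α // Elem t α p} => chi t α p.1) := by
    ext f
    constructor
    · rintro ⟨p, hp, rfl⟩
      exact ⟨⟨p, hp⟩, rfl⟩
    · rintro ⟨p, rfl⟩
      exact ⟨p.1, p.2, rfl⟩
  unfold chiHatSpan chiSpan
  rw [e1, e2, finrank_span_eq_card (linInd_chiHat t α), finrank_span_eq_card (linInd_chi t α)]

/-- Theorem `homom equal dim`.
For any fence `F`, the homomesic subspaces `I_H(F) ⊆ span{χ̂_p}` and
`A_H(F) ⊆ span{χ_p}` have the same dimension. -/
theorem statement19 (t : ℕ) (α : ℕ → ℕ) (hF : IsFence t α) :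
    Module.finrank ℝ (chiHatSpan t α ⊓ Homomesic t α : Submodule ℝ (J t α → ℝ))
      = Module.finrank ℝ (chiSpan t α ⊓ Homomesic t α : Submodule ℝ (J t α → ℝ)) := by
  have h1 := Submodule.finrank_sup_add_finrank_inf_eq (chiHatSpan t α) (Homomesic t α)
  have h2 := Submodule.finrank_sup_add_finrank_inf_eq (chiSpan t α) (Homomesic t α)
  have h3 := finrank_spans t α
  rw [sup_eq] at h1
  omega

end Fence
end
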